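/- arXiv:2408.00581 — 2 statements merged into one kernel-verified Lean document; each statement's English description precedes it below -/
import Mathlib

section
/- Define the adjoint Lyapunov operator L*(X) := AX + XAᵀ + Σ_{i,j=1}^q k_{ij} N_i X N_jᵀ for symmetric X ∈ ℝ^{n×n}. Suppose there exists a symmetric positive definite matrix X ∈ ℝ^{n×n} with L(X) negative definite (mean square asymptotic stability). Let X₀ ∈ ℝ^{n×d}, let P ∈ ℝ^{n×n} be symmetric and satisfy the equation L*(P) + X₀X₀ᵀ = 0, and let P̄ ∈ ℝ^{n×n} be symmetric and satisfy the inequality L*(P̄) + X₀X₀ᵀ ≤ 0. Then P̄ − P is positive semidefinite. -/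
open Matrix

/-- The operator `L(X) = AᵀX + XA + Σ_{i,j} k_{ij} N_iᵀ X N_j`. -/
noncomputable def Lop {n q : ℕ} (A : Matrix (Fin n) (Fin n) ℝ)
    (N : Fin q → Matrix (Fin n) (Fin n) ℝ) (K : Matrix (Fin q) (Fin q) ℝ)
    (X : Matrix (Fin n) (Fin n) ℝ) : Matrix (Fin n) (Fin n) ℝ :=
  Aᵀ * X + X * A + ∑ i, ∑ j, K i j • ((N i)ᵀ * X * N j)

/-- The adjoint operator `L*(X) = AX + XAᵀ + Σ_{i,j} k_{ij} N_i X N_jᵀ`. -/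
noncomputable def Lstar {n q : ℕ} (A : Matrix (Fin n) (Fin n) ℝ)
    (N : Fin q → Matrix (Fin n) (Fin n) ℝ) (K : Matrix (Fin q) (Fin q) ℝ)
    (X : Matrix (Fin n) (Fin n) ℝ) : Matrix (Fin n) (Fin n) ℝ :=
  A * X + X * Aᵀ + ∑ i, ∑ j, K i j • (N i * X * (N j)ᵀ)

lemma Matrix.PosSemidef.exists_eq_transpose_mul_self {n : ℕ} {Z : Matrix (Fin n) (Fin n) ℝ}
    (hZ : Z.PosSemidef) : ∃ B : Matrix (Fin n) (Fin n) ℝ, Z = Bᵀ * B := by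
  open scoped MatrixOrder ComplexOrder in
  obtain ⟨B, hB⟩ := CStarAlgebra.nonneg_iff_eq_star_mul_self.mp hZ.nonneg
  exact ⟨B, by rw [hB, star_eq_conjTranspose, conjTranspose_eq_transpose_of_trivial]⟩

lemma Matrix.PosSemidef.trace_mul_nonneg {n : ℕ} {M W : Matrix (Fin n) (Fin n) ℝ}
    (hM : M.PosSemidef) (hW : W.PosSemidef) : 0 ≤ (M * W).trace := by
  obtain ⟨B, rfl⟩ := hM.exists_eq_transpose_mul_self
  have h := (hW.mul_mul_conjTranspose_same B).trace_nonneg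
  rwa [conjTranspose_eq_transpose_of_trivial, trace_mul_comm, ← Matrix.mul_assoc] at h

/-- If `K` and `Z` are positive semidefinite, so is the form `∑ k_{ij} uᵢᵀ Z uⱼ`. -/
lemma sum_mul_dotProduct_mulVec_nonneg {n q : ℕ} {K : Matrix (Fin q) (Fin q) ℝ}
    (hK : K.PosSemidef) {Z : Matrix (Fin n) (Fin n) ℝ} (hZ : Z.PosSemidef)
    (u : Fin q → Fin n → ℝ) : 0 ≤ ∑ i, ∑ j, K i j * (u i ⬝ᵥ Z *ᵥ u j) := by
  obtain ⟨B, rfl⟩ := hZ.exists_eq_transpose_mul_self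
  have key : ∑ i, ∑ j, K i j * (u i ⬝ᵥ (Bᵀ * B) *ᵥ u j) =
      ∑ l, (fun i => (B *ᵥ u i) l) ⬝ᵥ K *ᵥ (fun j => (B *ᵥ u j) l) := by
    have h (i j : Fin q) : u i ⬝ᵥ (Bᵀ * B) *ᵥ u j = ∑ l, (B *ᵥ u i) l * (B *ᵥ u j) l := by
      rw [← mulVec_mulVec, dotProduct_mulVec, vecMul_transpose]
      rfl
    have h' (x : Fin q → ℝ) : x ⬝ᵥ K *ᵥ x = ∑ i, ∑ j, x i * (K i j * x j) := by
      simp only [dotProduct, mulVec, Finset.mul_sum]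
    simp only [h, h', Finset.mul_sum]
    rw [Finset.sum_comm_cycle]
    refine Finset.sum_congr rfl fun l _ => Finset.sum_congr rfl fun i _ =>
      Finset.sum_congr rfl fun j _ => ?_
    ring
  rw [key]
  exact Finset.sum_nonneg fun l _ => by
    simpa using hK.dotProduct_mulVec_nonneg (fun i => (B *ᵥ u i) l)

section Lyapunov

variable {n q : ℕ} (A : Matrix (Fin n) (Fin n) ℝ) (N : Fin q → Matrix (Fin n) (Fin n) ℝ)
  (K : Matrix (Fin q) (Fin q) ℝ)

lemma Lop_add (X Y : Matrix (Fin n) (Fin n) ℝ) :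
    Lop A N K (X + Y) = Lop A N K X + Lop A N K Y := by
  simp only [Lop, Matrix.mul_add, Matrix.add_mul, smul_add, Finset.sum_add_distrib]
  abel

lemma Lop_smul (c : ℝ) (X : Matrix (Fin n) (Fin n) ℝ) : Lop A N K (c • X) = c • Lop A N K X := by
  simp only [Lop, Matrix.mul_smul, Matrix.smul_mul, smul_add, Finset.smul_sum, smul_comm c]

lemma Lop_neg (X : Matrix (Fin n) (Fin n) ℝ) : Lop A N K (-X) = -Lop A N K X := by
  simpa using Lop_smul A N K (-1) X

lemma Lstar_sub (X Y : Matrix (Fin n) (Fin n) ℝ) :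
    Lstar A N K (X - Y) = Lstar A N K X - Lstar A N K Y := by
  simp only [Lstar, Matrix.mul_sub, Matrix.sub_mul, smul_sub, Finset.sum_sub_distrib]
  abel

variable {K}

lemma Lop_transpose (hK : K.PosSemidef) (X : Matrix (Fin n) (Fin n) ℝ) :
    (Lop A N K X)ᵀ = Lop A N K Xᵀ := by
  have hs (i j : Fin q) : K i j = K j i := by simpa using hK.isHermitian.apply j i
  simp only [Lop, transpose_add, transpose_mul, transpose_sum, transpose_smul, transpose_transpose]
  rw [Finset.sum_comm, add_comm (Xᵀ * A)]
  simp only [Matrix.mul_assoc, hs]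

/-- `L` and `L*` are adjoint for the trace pairing. -/
lemma trace_Lstar_mul (hK : K.PosSemidef) (D W : Matrix (Fin n) (Fin n) ℝ) :
    (Lstar A N K D * W).trace = (D * Lop A N K W).trace := by
  have hs (i j : Fin q) : K i j = K j i := by simpa using hK.isHermitian.apply j i
  have h1 : (A * D * W).trace = (D * (W * A)).trace := by
    rw [Matrix.mul_assoc, trace_mul_comm, Matrix.mul_assoc]
  have h2 (i j : Fin q) : (N i * D * (N j)ᵀ * W).trace = (D * ((N j)ᵀ * W * N i)).trace := by
    rw [Matrix.mul_assoc, Matrix.mul_assoc, trace_mul_comm]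
    simp only [Matrix.mul_assoc]
  simp only [Lstar, Lop, Matrix.add_mul, Matrix.mul_add, trace_add, Finset.sum_mul,
    Finset.mul_sum, trace_sum, Matrix.smul_mul, Matrix.mul_smul, trace_smul, h1, h2]
  rw [Finset.sum_comm (f := fun i j => K i j • (D * ((N j)ᵀ * W * N i)).trace)]
  simp only [hs]
  rw [Matrix.mul_assoc D Aᵀ W]
  ring

/-- On the kernel of a positive semidefinite `Z`, the form of `L(Z)` is nonnegative. -/
lemma dotProduct_Lop_mulVec_nonneg (hK : K.PosSemidef) {Z : Matrix (Fin n) (Fin n) ℝ}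
    (hZ : Z.PosSemidef) {v : Fin n → ℝ} (hv : Z *ᵥ v = 0) : 0 ≤ v ⬝ᵥ Lop A N K Z *ᵥ v := by
  have hZt : Zᵀ = Z := hZ.isHermitian
  have hv' : v ᵥ* Z = 0 := by rw [← hZt, vecMul_transpose, hv]
  have h1 : v ⬝ᵥ (Aᵀ * Z) *ᵥ v = 0 := by rw [← mulVec_mulVec, hv]; simp
  have h2 : v ⬝ᵥ (Z * A) *ᵥ v = 0 := by rw [← mulVec_mulVec, dotProduct_mulVec, hv']; simp
  have h3 (i j : Fin q) : v ⬝ᵥ ((N i)ᵀ * Z * N j) *ᵥ v = (N i *ᵥ v) ⬝ᵥ Z *ᵥ (N j *ᵥ v) := by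
    rw [Matrix.mul_assoc, ← mulVec_mulVec, dotProduct_mulVec, vecMul_transpose, mulVec_mulVec]
  have h := sum_mul_dotProduct_mulVec_nonneg hK hZ fun i => N i *ᵥ v
  simpa only [Lop, add_mulVec, dotProduct_add, h1, h2, sum_mulVec, dotProduct_sum, smul_mulVec,
    dotProduct_smul, smul_eq_mul, h3, zero_add] using h

/-- If a symmetric `W` is not positive semidefinite and `X` is positive definite, then
`W + t X` is positive semidefinite and singular for some `t > 0`. -/
lemma exists_posSemidef_add_smul_of_not_posSemidef {W X : Matrix (Fin n) (Fin n) ℝ}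
    (hW : W.IsSymm) (hX : X.PosDef) (hn : ¬ W.PosSemidef) :
    ∃ t : ℝ, 0 < t ∧ (W + t • X).PosSemidef ∧ ∃ v, v ≠ 0 ∧ (W + t • X) *ᵥ v = 0 := by
  have hWH : W.IsHermitian := hW
  have hXpos {x : Fin n → ℝ} (hx : x ≠ 0) : 0 < x ⬝ᵥ X *ᵥ x := by
    simpa using hX.dotProduct_mulVec_pos hx
  obtain ⟨w, hw⟩ : ∃ w : Fin n → ℝ, w ⬝ᵥ W *ᵥ w < 0 := by
    by_contra! h
    exact hn (.of_dotProduct_mulVec_nonneg hWH fun x => by simpa using h x)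
  have hw0 : w ≠ 0 := by rintro rfl; simp at hw
  set r : (Fin n → ℝ) → ℝ := fun x => (x ⬝ᵥ W *ᵥ x) / (x ⬝ᵥ X *ᵥ x) with hr
  have hscale (c : ℝ) (hc : c ≠ 0) (x : Fin n → ℝ) : r (c • x) = r x := by
    simp only [hr, mulVec_smul, dotProduct_smul, smul_dotProduct, smul_eq_mul]
    rw [mul_div_mul_left _ _ hc, mul_div_mul_left _ _ hc]
  have hunit {x : Fin n → ℝ} (hx : x ≠ 0) : ‖x‖⁻¹ • x ∈ Metric.sphere (0 : Fin n → ℝ) 1 := by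
    simp [norm_smul, hx]
  have hne {x : Fin n → ℝ} (hx : x ∈ Metric.sphere (0 : Fin n → ℝ) 1) : x ≠ 0 := by
    rintro rfl; simp at hx
  have hcont : ContinuousOn r (Metric.sphere 0 1) := by
    refine ContinuousOn.div ?_ ?_ fun x hx => (hXpos (hne hx)).ne'
    · exact (continuous_id.dotProduct (continuous_const.matrix_mulVec continuous_id)).continuousOn
    · exact (continuous_id.dotProduct (continuous_const.matrix_mulVec continuous_id)).continuousOn
  obtain ⟨v, hv, hmin⟩ := (isCompact_sphere (0 : Fin n → ℝ) 1).exists_isMinOn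
    ⟨_, hunit hw0⟩ hcont
  have hle {x : Fin n → ℝ} (hx : x ≠ 0) : r v ≤ r x := by
    rw [← hscale ‖x‖⁻¹ (by simpa using hx) x]
    exact hmin (hunit hx)
  have hform (x : Fin n → ℝ) :
      x ⬝ᵥ (W + -r v • X) *ᵥ x = x ⬝ᵥ W *ᵥ x - r v * (x ⬝ᵥ X *ᵥ x) := by
    simp only [add_mulVec, smul_mulVec, dotProduct_add, dotProduct_smul, smul_eq_mul]
    ring
  have hpsd : (W + -r v • X).PosSemidef := by
    refine .of_dotProduct_mulVec_nonneg (hWH.add (hX.isHermitian.smul (.all _))) fun x => ?_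
    rw [star_trivial, hform]
    by_cases hx : x = 0
    · simp [hx]
    · have := (le_div_iff₀ (hXpos hx)).mp (hle hx)
      linarith
  refine ⟨-r v, ?_, hpsd, v, hne hv, ?_⟩
  · have : r w < 0 := div_neg_of_neg_of_pos hw (hXpos hw0)
    linarith [hle hw0]
  · refine (hpsd.dotProduct_mulVec_zero_iff v).mp ?_
    rw [star_trivial, hform, hr]
    field_simp [(hXpos (hne hv)).ne']
    ring

/-- Under stability, `L(W) ≤ 0` implies `W ≥ 0`. -/
lemma posSemidef_of_neg_Lop_posSemidef (hK : K.PosSemidef) {X : Matrix (Fin n) (Fin n) ℝ}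
    (hX : X.PosDef) (hLX : (-(Lop A N K X)).PosDef) {W : Matrix (Fin n) (Fin n) ℝ}
    (hW : W.IsSymm) (hLW : (-(Lop A N K W)).PosSemidef) : W.PosSemidef := by
  by_contra hn
  obtain ⟨t, ht, hpsd, v, hv, hker⟩ := exists_posSemidef_add_smul_of_not_posSemidef hW hX hn
  have h := dotProduct_Lop_mulVec_nonneg A N hK hpsd hker
  have h1 : 0 < v ⬝ᵥ (-(Lop A N K X)) *ᵥ v := by simpa using hLX.dotProduct_mulVec_pos hv
  have h2 : 0 ≤ v ⬝ᵥ (-(Lop A N K W)) *ᵥ v := by simpa using hLW.dotProduct_mulVec_nonneg v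
  simp only [neg_mulVec, dotProduct_neg] at h1 h2
  simp only [Lop_add, Lop_smul, add_mulVec, smul_mulVec, dotProduct_add, dotProduct_smul,
    smul_eq_mul] at h
  nlinarith

/-- Under stability, `L` maps the symmetric matrices onto the symmetric matrices. -/
lemma exists_isSymm_Lop_eq (hK : K.PosSemidef) {X : Matrix (Fin n) (Fin n) ℝ}
    (hX : X.PosDef) (hLX : (-(Lop A N K X)).PosDef) {M : Matrix (Fin n) (Fin n) ℝ}
    (hM : M.IsSymm) : ∃ W : Matrix (Fin n) (Fin n) ℝ, W.IsSymm ∧ Lop A N K W = M := by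
  let S : Submodule ℝ (Matrix (Fin n) (Fin n) ℝ) :=
    { carrier := {W | W.IsSymm}
      add_mem' := fun h h' => IsSymm.add h h'
      zero_mem' := isSymm_zero
      smul_mem' := fun c _ h => IsSymm.smul h c }
  let T : Matrix (Fin n) (Fin n) ℝ →ₗ[ℝ] Matrix (Fin n) (Fin n) ℝ :=
    { toFun := Lop A N K
      map_add' := Lop_add A N K
      map_smul' := Lop_smul A N K }
  have hT : ∀ W ∈ S, T W ∈ S := fun W (hW : Wᵀ = W) => by
    change (Lop A N K W)ᵀ = Lop A N K W
    rw [Lop_transpose A N hK, hW]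
  have hinj : Function.Injective (T.restrict hT) := by
    rw [injective_iff_map_eq_zero]
    rintro ⟨W, hW⟩ h
    have hLW : Lop A N K W = 0 := congrArg Subtype.val h
    have h1 := posSemidef_of_neg_Lop_posSemidef A N hK hX hLX (W := W) hW
      (by rw [hLW, neg_zero]; exact .zero)
    have h2 := posSemidef_of_neg_Lop_posSemidef A N hK hX hLX (W := -W) (IsSymm.neg hW)
      (by rw [Lop_neg, hLW, neg_zero, neg_zero]; exact .zero)
    refine Subtype.ext ?_
    open scoped MatrixOrder in
    exact le_antisymm (neg_nonneg.mp h2.nonneg) h1.nonneg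
  obtain ⟨⟨W, hW⟩, h⟩ := LinearMap.injective_iff_surjective.mp hinj ⟨M, hM⟩
  exact ⟨W, hW, congrArg Subtype.val h⟩

/-- Under stability, `L*(D) ≤ 0` implies `D ≥ 0`. -/
lemma posSemidef_of_neg_Lstar_posSemidef (hK : K.PosSemidef) {X : Matrix (Fin n) (Fin n) ℝ}
    (hX : X.PosDef) (hLX : (-(Lop A N K X)).PosDef) {D : Matrix (Fin n) (Fin n) ℝ}
    (hD : D.IsSymm) (hLD : (-(Lstar A N K D)).PosSemidef) : D.PosSemidef := by
  refine .of_dotProduct_mulVec_nonneg hD fun v => ?_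
  have hvv : (vecMulVec v v).PosSemidef := by simpa using posSemidef_vecMulVec_self_star v
  obtain ⟨W, hW, hLW⟩ := exists_isSymm_Lop_eq A N hK hX hLX (M := -vecMulVec v v)
    (IsSymm.neg hvv.isHermitian)
  have hWpsd := posSemidef_of_neg_Lop_posSemidef A N hK hX hLX hW (by rwa [hLW, neg_neg])
  have h := hLD.trace_mul_nonneg hWpsd
  rw [Matrix.neg_mul, trace_neg, trace_Lstar_mul A N hK, hLW, Matrix.mul_neg, trace_neg, neg_neg,
    mul_vecMulVec, trace_vecMulVec] at h
  rwa [star_trivial, dotProduct_comm]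

end Lyapunov

/-- Under mean square asymptotic stability (there is a symmetric positive
definite `X` with `L(X)` negative definite), if the symmetric matrix `P` solves the equation
`L*(P) + X₀X₀ᵀ = 0` and the symmetric matrix `P̄` solves the inequality `L*(P̄) + X₀X₀ᵀ ≤ 0`,
then `P̄ − P` is positive semidefinite. -/
theorem lyapunov_inequality_comparison {n d q : ℕ} [NeZero n] [NeZero d] [NeZero q]
    (A : Matrix (Fin n) (Fin n) ℝ) (N : Fin q → Matrix (Fin n) (Fin n) ℝ)
    (X₀ : Matrix (Fin n) (Fin d) ℝ)
    (K : Matrix (Fin q) (Fin q) ℝ) (hK : K.PosSemidef)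
    (X : Matrix (Fin n) (Fin n) ℝ) (hX : X.PosDef) (hLX : (-(Lop A N K X)).PosDef)
    (P : Matrix (Fin n) (Fin n) ℝ) (hPsym : P.IsSymm)
    (hP : Lstar A N K P + X₀ * X₀ᵀ = 0)
    (Pbar : Matrix (Fin n) (Fin n) ℝ) (hPbarsym : Pbar.IsSymm)
    (hPbar : (-(Lstar A N K Pbar + X₀ * X₀ᵀ)).PosSemidef) :
    (Pbar - P).PosSemidef := by
  refine posSemidef_of_neg_Lstar_posSemidef A N hK hX hLX (hPbarsym.sub hPsym) ?_
  rwa [Lstar_sub, eq_neg_of_add_eq_zero_left hP, sub_neg_eq_add]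
end

section
/- Let X, Y ∈ ℝ^{n×n} be symmetric with X positive definite, Y positive definite, and L(X) = −Y. Let λ_max be the largest eigenvalue of the positive semidefinite matrix W := Σ_{i,j=1}^q k_{ij} M_iᵀ X M_j, let λ^Y_min > 0 be the smallest eigenvalue of Y, and let λ^{SSᵀ}_max ≥ 0 be the largest eigenvalue of S(X)S(X)ᵀ. Then for every ε > 0 with ε λ_max < γ, the matrix U(εX) = γI_m − εW is positive definite and εY − S(εX) U(εX)^{-1} S(εX)ᵀ ≥ (ε λ^Y_min − ε² λ^{SSᵀ}_max / (γ − ε λ_max)) · I_n. -/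
open Matrix

/-- The operator `S(X) = XB + Σ_{i,j} k_{ij} N_iᵀ X M_j`. -/
noncomputable def Sop {n m q : ℕ} (B : Matrix (Fin n) (Fin m) ℝ)
    (N : Fin q → Matrix (Fin n) (Fin n) ℝ) (M : Fin q → Matrix (Fin n) (Fin m) ℝ)
    (K : Matrix (Fin q) (Fin q) ℝ) (X : Matrix (Fin n) (Fin n) ℝ) : Matrix (Fin n) (Fin m) ℝ :=
  X * B + ∑ i, ∑ j, K i j • ((N i)ᵀ * X * M j)

/-- The operator `U(X) = γ I_m − Σ_{i,j} k_{ij} M_iᵀ X M_j`. -/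
noncomputable def Uop {n m q : ℕ} (γ : ℝ) (M : Fin q → Matrix (Fin n) (Fin m) ℝ)
    (K : Matrix (Fin q) (Fin q) ℝ) (X : Matrix (Fin n) (Fin n) ℝ) : Matrix (Fin m) (Fin m) ℝ :=
  γ • (1 : Matrix (Fin m) (Fin m) ℝ) - ∑ i, ∑ j, K i j • ((M i)ᵀ * X * M j)

theorem posSemidef_smul_one_sub_of_spectrum_le {k : ℕ} {P : Matrix (Fin k) (Fin k) ℝ}
    (hP : P.IsHermitian) {c : ℝ} (hc : c ∈ upperBounds (spectrum ℝ P)) :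
    (c • (1 : Matrix (Fin k) (Fin k) ℝ) - P).PosSemidef := by
  rw [posSemidef_iff_isHermitian_and_spectrum_nonneg]
  refine ⟨(isHermitian_one.smul (IsSelfAdjoint.all c)).sub hP, fun r hr => ?_⟩
  rw [← Algebra.algebraMap_eq_smul_one, ← spectrum.singleton_sub_eq] at hr
  obtain ⟨_, rfl, s, hs, rfl⟩ := hr
  exact sub_nonneg.2 (hc hs)

theorem posSemidef_sub_smul_one_of_le_spectrum {k : ℕ} {P : Matrix (Fin k) (Fin k) ℝ}
    (hP : P.IsHermitian) {c : ℝ} (hc : c ∈ lowerBounds (spectrum ℝ P)) :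
    (P - c • (1 : Matrix (Fin k) (Fin k) ℝ)).PosSemidef := by
  rw [posSemidef_iff_isHermitian_and_spectrum_nonneg]
  refine ⟨hP.sub (isHermitian_one.smul (IsSelfAdjoint.all c)), fun r hr => ?_⟩
  rw [← Algebra.algebraMap_eq_smul_one, ← spectrum.sub_singleton_eq] at hr
  obtain ⟨s, hs, _, rfl, rfl⟩ := hr
  exact sub_nonneg.2 (hc hs)

theorem posSemidef_inv_smul_one_sub_inv {k : ℕ} {P : Matrix (Fin k) (Fin k) ℝ} {d : ℝ}
    (hd : 0 < d) (hP : (P - d • (1 : Matrix (Fin k) (Fin k) ℝ)).PosSemidef) (hP' : P.PosDef) :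
    (d⁻¹ • (1 : Matrix (Fin k) (Fin k) ℝ) - P⁻¹).PosSemidef := by
  set Q := P - d • (1 : Matrix (Fin k) (Fin k) ℝ) with hQ
  have hQQ : (Q * Q).PosSemidef := by
    simpa only [hP.isHermitian.eq] using posSemidef_self_mul_conjTranspose Q
  have h := (((hP.smul hd.le).add hQQ).mul_mul_conjTranspose_same P⁻¹).smul (inv_nonneg.2 hd.le)
  rw [hP'.isHermitian.inv.eq] at h
  have hu : IsUnit P.det := (isUnit_iff_isUnit_det P).1 hP'.isUnit
  have hfac : d • Q + Q * Q = P * Q := by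
    rw [hQ, sub_mul P (d • 1) (P - d • 1), Matrix.smul_mul, Matrix.one_mul]
    abel
  convert h using 1
  rw [hfac, Matrix.nonsing_inv_mul_cancel_left _ _ hu, hQ, Matrix.sub_mul,
    Matrix.mul_nonsing_inv P hu, Matrix.smul_mul, Matrix.one_mul, smul_sub, smul_smul,
    inv_mul_cancel₀ hd.ne', one_smul]

theorem Sop_smul {n m q : ℕ} (B : Matrix (Fin n) (Fin m) ℝ)
    (N : Fin q → Matrix (Fin n) (Fin n) ℝ) (M : Fin q → Matrix (Fin n) (Fin m) ℝ)
    (K : Matrix (Fin q) (Fin q) ℝ) (X : Matrix (Fin n) (Fin n) ℝ) (ε : ℝ) :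
    Sop B N M K (ε • X) = ε • Sop B N M K X := by
  simp only [Sop, Matrix.smul_mul, Matrix.mul_smul, smul_add, Finset.smul_sum]
  simp only [smul_comm ε]

theorem Uop_smul {n m q : ℕ} (γ : ℝ) (M : Fin q → Matrix (Fin n) (Fin m) ℝ)
    (K : Matrix (Fin q) (Fin q) ℝ) (X : Matrix (Fin n) (Fin n) ℝ) (ε : ℝ) :
    Uop γ M K (ε • X) = γ • (1 : Matrix (Fin m) (Fin m) ℝ) -
      ε • ∑ i, ∑ j, K i j • ((M i)ᵀ * X * M j) := by
  simp only [Uop, Matrix.smul_mul, Matrix.mul_smul, Finset.smul_sum]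
  simp only [smul_comm ε]

theorem isHermitian_sum_smul_transpose_mul_mul {n m q : ℕ} (M : Fin q → Matrix (Fin n) (Fin m) ℝ)
    {K : Matrix (Fin q) (Fin q) ℝ} (hK : K.IsHermitian)
    {X : Matrix (Fin n) (Fin n) ℝ} (hX : X.IsHermitian) :
    (∑ i, ∑ j, K i j • ((M i)ᵀ * X * M j)).IsHermitian := by
  have hX' : Xᵀ = X := by simpa using hX.eq
  have hK' : ∀ i j, K i j = K j i := fun i j => by simpa using hK.apply j i
  rw [IsHermitian, conjTranspose_eq_transpose_of_trivial]
  simp only [transpose_sum, transpose_smul, transpose_mul, transpose_transpose, hX']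
  rw [Finset.sum_comm]
  refine Finset.sum_congr rfl fun i _ => Finset.sum_congr rfl fun j _ => ?_
  rw [hK' j i, Matrix.mul_assoc]

/-- Let `X, Y` be symmetric positive definite with `L(X) = −Y`.  Let `λ_max` be
the largest eigenvalue of `W := Σ_{i,j} k_{ij} M_iᵀ X M_j`, `λ^Y_min` the smallest eigenvalue
of `Y`, and `λ^{SSᵀ}_max` the largest eigenvalue of `S(X)S(X)ᵀ`.  Then for every `ε > 0` with
`ε λ_max < γ`, the matrix `U(εX) = γI − εW` is positive definite and
`εY − S(εX) U(εX)⁻¹ S(εX)ᵀ ≥ (ε λ^Y_min − ε² λ^{SSᵀ}_max/(γ − ε λ_max)) I`. -/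
theorem epsilon_scaling_estimate {n m q : ℕ} [NeZero n] [NeZero m] [NeZero q]
    (A : Matrix (Fin n) (Fin n) ℝ) (N : Fin q → Matrix (Fin n) (Fin n) ℝ)
    (B : Matrix (Fin n) (Fin m) ℝ) (M : Fin q → Matrix (Fin n) (Fin m) ℝ)
    (K : Matrix (Fin q) (Fin q) ℝ) (hK : K.PosSemidef)
    (γ : ℝ) (hγ : 0 < γ)
    (X Y : Matrix (Fin n) (Fin n) ℝ) (hX : X.PosDef) (hY : Y.PosDef)
    (hLXY : Lop A N K X = -Y)
    (lmax lYmin lSS : ℝ)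
    (hlmax : IsGreatest (spectrum ℝ (∑ i, ∑ j, K i j • ((M i)ᵀ * X * M j))) lmax)
    (hlYmin : IsLeast (spectrum ℝ Y) lYmin)
    (hlSS : IsGreatest (spectrum ℝ (Sop B N M K X * (Sop B N M K X)ᵀ)) lSS)
    (ε : ℝ) (hε : 0 < ε) (hεγ : ε * lmax < γ) :
    (Uop γ M K (ε • X)).PosDef ∧
    (ε • Y - Sop B N M K (ε • X) * (Uop γ M K (ε • X))⁻¹ * (Sop B N M K (ε • X))ᵀ -
        (ε * lYmin - ε ^ 2 * lSS / (γ - ε * lmax)) •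
          (1 : Matrix (Fin n) (Fin n) ℝ)).PosSemidef := by
  set W := ∑ i, ∑ j, K i j • ((M i)ᵀ * X * M j) with hW
  set S := Sop B N M K X with hS
  rw [Sop_smul, Uop_smul, ← hW, ← hS]
  set U := γ • (1 : Matrix (Fin m) (Fin m) ℝ) - ε • W with hU
  set δ := γ - ε * lmax with hδ
  have hδ0 : 0 < δ := sub_pos.2 hεγ
  have hWh : W.IsHermitian := isHermitian_sum_smul_transpose_mul_mul M hK.isHermitian hX.isHermitian
  have hUδ : (U - δ • (1 : Matrix (Fin m) (Fin m) ℝ)).PosSemidef := by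
    convert (posSemidef_smul_one_sub_of_spectrum_le hWh hlmax.2).smul hε.le using 1
    rw [hU, hδ]
    module
  have hUpos : U.PosDef := by
    simpa using PosDef.posSemidef_add hUδ (PosDef.one.smul hδ0)
  refine ⟨hUpos, ?_⟩
  have hUinv := (posSemidef_inv_smul_one_sub_inv hδ0 hUδ hUpos).mul_mul_conjTranspose_same S
  have hSS := posSemidef_smul_one_sub_of_spectrum_le
    (by simpa using isHermitian_mul_conjTranspose_self S) hlSS.2
  have hYs := posSemidef_sub_smul_one_of_le_spectrum hY.isHermitian hlYmin.2
  convert ((hYs.smul hε.le).add (hUinv.smul (sq_nonneg ε))).add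
    (hSS.smul (div_nonneg (sq_nonneg ε) hδ0.le)) using 1
  simp only [conjTranspose_eq_transpose_of_trivial, Matrix.mul_sub, Matrix.sub_mul,
    Matrix.mul_smul, Matrix.smul_mul, transpose_smul, Matrix.mul_one]
  module
end
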